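/- Let G be an ADMG on n vertices and suppose there are m distinct vertex subsets V_1,...,V_m, each of size 3, such that for every i the induced subgraph G[V_i] contains (on some ordering (v_1,v_2,v_3) of V_i) either a copy of S (edges v_1→v_2, v_2→v_3, v_2↔v_3) or a copy of S̄ (edges v_1→v_2, v_2→v_3, v_2↔v_3, v_1→v_3). Then |MEC(G)| ≥ 2^{m/(3n)}. -/

import Mathlib

namespace CausalMEC

/-- A directed graph on `Fin n`, given by a Boolean edge function (`d a b = true` means `a → b`). -/
abbrev Dir (n : ℕ) := Fin n → Fin n → Bool

/-- Directed reachability (zero or more steps). -/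
def Reach {n : ℕ} (d : Dir n) : Fin n → Fin n → Prop :=
  Relation.ReflTransGen fun a b => d a b = true

/-- No directed cycles (including no self-loops). -/
def Acyclic {n : ℕ} (d : Dir n) : Prop :=
  ∀ v, ¬ Relation.TransGen (fun a b => d a b = true) v v

/-- A directed acyclic graph. -/
def IsDAG {n : ℕ} (d : Dir n) : Prop :=
  (∀ v, d v v = false) ∧ Acyclic d

/-- A directed (possibly cyclic) graph with edges between distinct vertices. -/
def IsDCG {n : ℕ} (d : Dir n) : Prop :=
  ∀ v, d v v = false

/-- The number of directed edges. -/
def edgeCount {n : ℕ} (d : Dir n) : ℕ :=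
  (Finset.univ.filter fun q : Fin n × Fin n => d q.1 q.2 = true).card

/-- The parent set of a vertex. -/
def parents {n : ℕ} (d : Dir n) (v : Fin n) : Finset (Fin n) :=
  Finset.univ.filter fun u => d u v = true

/-! ### Paths, d-connection and Markov equivalence in mixed graphs
A mixed graph is given by a directed part `d` and a bidirected part `b`. -/

/-- The kind of a step on a path: a directed edge traversed forwards, a directed edge
traversed backwards, or a bidirected edge. -/
inductive EdgeKind : Type
  | fwd | bwd | bidir
deriving DecidableEq

/-- Does the step point into its second endpoint? -/
def EdgeKind.intoSnd : EdgeKind → Bool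
  | .fwd => true
  | .bwd => false
  | .bidir => true

/-- Does the step point into its first endpoint? -/
def EdgeKind.intoFst : EdgeKind → Bool
  | .fwd => false
  | .bwd => true
  | .bidir => true

/-- A (possibly self-intersecting) path from `u` to `v` in the mixed graph `(d, b)`. -/
structure MPath {n : ℕ} (d b : Dir n) (u v : Fin n) where
  len : ℕ
  vert : Fin (len + 1) → Fin n
  kind : Fin len → EdgeKind
  first_eq : vert 0 = u
  last_eq : vert (Fin.last len) = v
  valid : ∀ i : Fin len,
    (kind i = .fwd → d (vert i.castSucc) (vert i.succ) = true) ∧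
    (kind i = .bwd → d (vert i.succ) (vert i.castSucc) = true) ∧
    (kind i = .bidir → b (vert i.castSucc) (vert i.succ) = true)

/-- Whether the internal vertex at position `i` of a path is a collider. -/
def MPath.colliderAt {n : ℕ} {d b : Dir n} {u v : Fin n} (π : MPath d b u v)
    (i : ℕ) (h1 : 0 < i) (h2 : i < π.len) : Bool :=
  (π.kind ⟨i - 1, by omega⟩).intoSnd && (π.kind ⟨i, h2⟩).intoFst

/-- A path is active given a conditioning set `Z` if every non-collider on it avoids `Z`
and every collider on it is in `Z` or has a descendant in `Z`. -/
def MPath.Active {n : ℕ} {d b : Dir n} {u v : Fin n} (π : MPath d b u v)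
    (Z : Finset (Fin n)) : Prop :=
  ∀ (i : ℕ) (h1 : 0 < i) (h2 : i < π.len),
    (π.colliderAt i h1 h2 = true →
      ∃ x ∈ Z, Reach d (π.vert ⟨i, by omega⟩) x) ∧
    (π.colliderAt i h1 h2 = false →
      π.vert ⟨i, by omega⟩ ∉ Z)

/-- d-connection given a conditioning set. -/
def DConn {n : ℕ} (d b : Dir n) (u v : Fin n) (Z : Finset (Fin n)) : Prop :=
  ∃ π : MPath d b u v, π.Active Z

/-- Markov equivalence of two mixed graphs: the same d-connection relations. -/
def MarkovEquiv {n : ℕ} (d b d' b' : Dir n) : Prop :=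
  ∀ (u v : Fin n) (Z : Finset (Fin n)), u ≠ v → u ∉ Z → v ∉ Z →
    (DConn d b u v Z ↔ DConn d' b' u v Z)

/-- The empty bidirected part: a purely directed graph. -/
def noBi (n : ℕ) : Dir n := fun _ _ => false

/-- Markov equivalence for purely directed graphs. -/
def MarkovEquivD {n : ℕ} (d d' : Dir n) : Prop :=
  MarkovEquiv d (noBi n) d' (noBi n)

/-- The Markov equivalence class of a DAG (within DAGs). -/
def MECdag {n : ℕ} (d : Dir n) : Set (Dir n) :=
  {d' | IsDAG d' ∧ MarkovEquivD d d'}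

/-- An acyclic directed mixed graph. -/
def IsADMG {n : ℕ} (d b : Dir n) : Prop :=
  IsDAG d ∧ (∀ v w, b v w = b w v) ∧ (∀ v, b v v = false)

/-- The Markov equivalence class of an ADMG (within ADMGs). -/
def MECadmg {n : ℕ} (d b : Dir n) : Set (Dir n × Dir n) :=
  {G | IsADMG G.1 G.2 ∧ MarkovEquiv d b G.1 G.2}

/-- The Markov equivalence class of a DCG (within DCGs). -/
def MECdcg {n : ℕ} (d : Dir n) : Set (Dir n) :=
  {d' | IsDCG d' ∧ MarkovEquivD d d'}

/-! ### The distribution `D(n,p)` and uniform ADMGs/DCGs -/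

/-- The (unnormalized) weight of a DAG under `D(n,p)`. -/
noncomputable def dagWeight {n : ℕ} (p : ℝ) (d : Dir n) : ℝ :=
  (p / (1 - p)) ^ edgeCount d

open scoped Classical in
/-- Probability of the event `A` under `D(n,p)`. -/
noncomputable def prD (n : ℕ) (p : ℝ) (A : Dir n → Prop) : ℝ :=
  (∑ d : Dir n, if IsDAG d ∧ A d then dagWeight p d else 0) /
    (∑ d : Dir n, if IsDAG d then dagWeight p d else 0)

open scoped Classical in
/-- Expectation of `f` under `D(n,p)`. -/
noncomputable def expD (n : ℕ) (p : ℝ) (f : Dir n → ℝ) : ℝ :=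
  (∑ d : Dir n, if IsDAG d then f d * dagWeight p d else 0) /
    (∑ d : Dir n, if IsDAG d then dagWeight p d else 0)

/-- Conditional probability of `A` given `B` under `D(n,p)`. -/
noncomputable def condPrD (n : ℕ) (p : ℝ) (A B : Dir n → Prop) : ℝ :=
  prD n p (fun d => A d ∧ B d) / prD n p B

open scoped Classical in
/-- Expectation of `f` under the uniform distribution on ADMGs on `n` vertices. -/
noncomputable def expADMG (n : ℕ) (f : Dir n × Dir n → ℝ) : ℝ :=
  (∑ G : Dir n × Dir n, if IsADMG G.1 G.2 then f G else 0) /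
    (∑ G : Dir n × Dir n, if IsADMG G.1 G.2 then (1 : ℝ) else 0)

open scoped Classical in
/-- Expectation of `f` under the uniform distribution on DCGs on `n` vertices. -/
noncomputable def expDCG (n : ℕ) (f : Dir n → ℝ) : ℝ :=
  (∑ d : Dir n, if IsDCG d then f d else 0) /
    (∑ d : Dir n, if IsDCG d then (1 : ℝ) else 0)

open scoped Classical in
/-- Probability of the event `A` under the uniform distribution on DCGs on `n` vertices. -/
noncomputable def prDCG (n : ℕ) (A : Dir n → Prop) : ℝ :=
  (∑ d : Dir n, if IsDCG d ∧ A d then (1 : ℝ) else 0) /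
    (∑ d : Dir n, if IsDCG d then (1 : ℝ) else 0)

/-! ### Tower decomposition -/

/-- The sources of `d` within a vertex set `S` (no parents inside `S`). -/
def sourcesIn {n : ℕ} (d : Dir n) (S : Finset (Fin n)) : Finset (Fin n) :=
  S.filter fun v => ∀ u ∈ S, d u v = false

/-- The vertices remaining after peeling off `k` layers of sources. -/
def remaining {n : ℕ} (d : Dir n) : ℕ → Finset (Fin n)
  | 0 => Finset.univ
  | k + 1 => remaining d k \ sourcesIn d (remaining d k)

/-- The `i`-th layer (1-based) of the tower decomposition of `d`. -/
def towerLayer {n : ℕ} (d : Dir n) (i : ℕ) : Finset (Fin n) :=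
  sourcesIn d (remaining d (i - 1))

/-- The 1-based index of the layer containing `v`. -/
def layerIdx {n : ℕ} (d : Dir n) (v : Fin n) : ℕ :=
  ((Finset.range n).filter fun j => v ∈ remaining d j).card

/-- The tower of a DAG: only the edges between adjacent layers are kept. -/
def tower {n : ℕ} (d : Dir n) : Dir n :=
  fun a c => d a c && decide (layerIdx d c = layerIdx d a + 1)

/-- `h` is the tower vector of `d` (layer sizes, 1-based, and no further layers). -/
def hasTowerVector {n : ℕ} (d : Dir n) (h : List ℕ) : Prop :=
  (∀ i : Fin h.length, (towerLayer d (i.val + 1)).card = h.get i) ∧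
    towerLayer d (h.length + 1) = ∅

/-- `H` is the tower decomposition of `d`. -/
def hasTowerDecomp {n : ℕ} (d : Dir n) (H : List (Finset (Fin n))) : Prop :=
  (∀ i : Fin H.length, towerLayer d (i.val + 1) = H.get i) ∧
    towerLayer d (H.length + 1) = ∅

/-- The weight `w(h)` of a tower vector `h = (h_1, …, h_s)`. -/
noncomputable def towerWeight (p : ℝ) (h : List ℕ) : ℝ :=
  (Nat.multinomial Finset.univ (fun i : Fin h.length => h.get i) : ℝ) *
    ∏ k ∈ Finset.Icc 2 h.length,
      (1 - (1 - p) ^ h.getD (k - 2) 0) ^ h.getD (k - 1) 0 /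
        (1 - p) ^ (h.getD (k - 1) 0 * ∑ i ∈ Finset.range (k - 1), h.getD i 0)

/-! ### Edge reversal and deletion -/

/-- Reverse the edge `v → w`. -/
def reverseEdge {n : ℕ} (d : Dir n) (v w : Fin n) : Dir n :=
  fun a c => if a = v ∧ c = w then false else if a = w ∧ c = v then true else d a c

/-- Delete the edge `v → w`. -/
def deleteEdge {n : ℕ} (d : Dir n) (v w : Fin n) : Dir n :=
  fun a c => if a = v ∧ c = w then false else d a c

/-- The edge `v → w` of a DAG is reversible: reversing it yields a Markov-equivalent DAG. -/
def Reversible {n : ℕ} (d : Dir n) (v w : Fin n) : Prop :=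
  d v w = true ∧ IsDAG (reverseEdge d v w) ∧ MarkovEquivD d (reverseEdge d v w)

/-- `d` has a matching of reversible layer-2-edges of size at least `m`. -/
def hasRevL2Matching {n : ℕ} (d : Dir n) (m : ℝ) : Prop :=
  ∃ S : Finset (Fin n × Fin n),
    (∀ e ∈ S, Reversible d e.1 e.2 ∧ e.2 ∈ towerLayer d 2) ∧
    (∀ e ∈ S, ∀ e' ∈ S, e ≠ e' →
      e.1 ≠ e'.1 ∧ e.1 ≠ e'.2 ∧ e.2 ≠ e'.1 ∧ e.2 ≠ e'.2) ∧
    m ≤ (S.card : ℝ)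

/-! ### Cycles and the `Reverse` construction -/

/-- Cyclic successor in `Fin k`. -/
def cycSucc {k : ℕ} (i : Fin k) : Fin k :=
  ⟨(i.val + 1) % k, Nat.mod_lt _ i.pos⟩

/-- The reversed parametrization of a cycle. -/
def cycRev {n k : ℕ} (c : Fin k → Fin n) : Fin k → Fin n :=
  fun i => c ⟨(k - i.val) % k, Nat.mod_lt _ i.pos⟩

/-- `c` lists the (distinct) vertices of a directed cycle of `d`, in order. -/
def IsCycle {n k : ℕ} (d : Dir n) (c : Fin k → Fin n) : Prop :=
  Function.Injective c ∧ ∀ i, d (c i) (c (cycSucc i)) = true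

/-- The `Reverse(G, C)` construction: reverse the cycle `c` and redirect every edge
`w → v_i` with `w ∈ Pa(v_i) \ {v_{i-1}}` to `w → v_{i-1}`. -/
def reverseCycle {n k : ℕ} (d : Dir n) (c : Fin k → Fin n) : Dir n :=
  fun a e =>
    decide ((∃ j : Fin k, e = c j ∧
        (a = c (cycSucc j) ∨ (d a (c (cycSucc j)) = true ∧ a ≠ c j))) ∨
      ((∀ j : Fin k, e ≠ c j) ∧ d a e = true))

/-- A vertex triple induces exactly a directed 3-cycle. -/
def induces3Cycle {n : ℕ} (d : Dir n) (W : Finset (Fin n)) : Prop :=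
  ∃ a b c : Fin n, W = {a, b, c} ∧ a ≠ b ∧ a ≠ c ∧ b ≠ c ∧
    d a b = true ∧ d b c = true ∧ d c a = true ∧
    d b a = false ∧ d c b = false ∧ d a c = false

/-- A single step of kind `k` from `u` to `v` in the mixed graph `(d, b)`. -/
def Step {n : ℕ} (d b : Dir n) (u : Fin n) (k : EdgeKind) (v : Fin n) : Prop :=
  (k = .fwd → d u v = true) ∧ (k = .bwd → d v u = true) ∧ (k = .bidir → b u v = true)

/-- The vertex `v`, entered by a step of kind `k` and left by one of kind `l`, does not block
a path given `Z`. -/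
def Passable {n : ℕ} (d : Dir n) (Z : Finset (Fin n)) (v : Fin n) (k l : EdgeKind) : Prop :=
  ((k.intoSnd && l.intoFst) = true → ∃ x ∈ Z, Reach d v x) ∧
    ((k.intoSnd && l.intoFst) = false → v ∉ Z)

/-- There is an active path with at least one step from `u` to `v` whose last step has
kind `k`. -/
inductive ActiveTo {n : ℕ} (d b : Dir n) (Z : Finset (Fin n)) (u : Fin n) :
    Fin n → EdgeKind → Prop
  | single {v : Fin n} {k : EdgeKind} : Step d b u k v → ActiveTo d b Z u v k
  | snoc {v w : Fin n} {k l : EdgeKind} : ActiveTo d b Z u v k → Step d b v l w →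
      Passable d Z v k l → ActiveTo d b Z u w l

theorem MPath.Active.activeTo {n : ℕ} {d b : Dir n} {u v : Fin n} {Z : Finset (Fin n)}
    {π : MPath d b u v} (h : π.Active Z) (i : ℕ) (hi : i < π.len) :
    ActiveTo d b Z u (π.vert ⟨i + 1, by omega⟩) (π.kind ⟨i, hi⟩) := by
  induction i with
  | zero =>
    have h0 := π.valid ⟨0, hi⟩
    have h1 : π.vert (Fin.castSucc ⟨0, hi⟩) = u := π.first_eq
    rw [h1] at h0
    exact .single h0
  | succ i ih =>
    exact .snoc (ih (by omega)) (π.valid ⟨i + 1, hi⟩) (h (i + 1) (by omega) hi)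

theorem ActiveTo.exists_seq {n : ℕ} {d b : Dir n} {Z : Finset (Fin n)} {u v : Fin n}
    {k : EdgeKind} (h : ActiveTo d b Z u v k) :
    ∃ (L : ℕ) (f : ℕ → Fin n) (g : ℕ → EdgeKind), f 0 = u ∧ f (L + 1) = v ∧ g L = k ∧
      (∀ i ≤ L, Step d b (f i) (g i) (f (i + 1))) ∧
      ∀ i < L, Passable d Z (f (i + 1)) (g i) (g (i + 1)) := by
  induction h with
  | @single v k hs =>
    refine ⟨0, fun i => if i = 0 then u else v, fun _ => k, rfl, rfl, rfl, ?_, by simp⟩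
    intro i hi
    obtain rfl : i = 0 := by omega
    exact hs
  | @snoc v w k l _ hs hp ih =>
    obtain ⟨L, f, g, h0, hv, hk, hst, hpa⟩ := ih
    refine ⟨L + 1, fun i => if i ≤ L + 1 then f i else w, fun i => if i ≤ L then g i else l,
      by simp [h0], by simp, by simp, ?_, ?_⟩
    · intro i hi
      rcases Nat.lt_or_ge L i with h | h
      · obtain rfl : i = L + 1 := by omega
        simpa [hv] using hs
      · simpa [h, show i ≤ L + 1 by omega] using hst i h
    · intro i hi
      rcases Nat.lt_or_ge i L with h | h
      · simpa [h, h.le, show i + 1 ≤ L by omega] using hpa i h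
      · obtain rfl : i = L := by omega
        simpa [hv, hk] using hp

theorem dConn_iff_activeTo {n : ℕ} {d b : Dir n} {Z : Finset (Fin n)} {u v : Fin n}
    (huv : u ≠ v) : DConn d b u v Z ↔ ∃ k, ActiveTo d b Z u v k := by
  constructor
  · rintro ⟨π, hπ⟩
    rcases Nat.eq_zero_or_pos π.len with h | h
    · refine absurd ?_ huv
      refine π.first_eq.symm.trans (.trans (congrArg π.vert ?_) π.last_eq)
      ext
      simp [h]
    · have := hπ.activeTo (π.len - 1) (by omega)
      have hl : π.vert ⟨π.len - 1 + 1, by omega⟩ = v := by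
        refine .trans (congrArg π.vert ?_) π.last_eq
        ext
        simp only [Fin.val_last]
        omega
      rw [hl] at this
      exact ⟨_, this⟩
  · rintro ⟨k, h⟩
    obtain ⟨L, f, g, h0, hv, -, hst, hpa⟩ := h.exists_seq
    refine ⟨⟨L + 1, fun i => f i, fun i => g i, by simpa using h0, by simpa using hv,
      fun i => hst i (by omega)⟩, ?_⟩
    intro i h1 h2
    obtain ⟨j, rfl⟩ : ∃ j, i = j + 1 := ⟨i - 1, by omega⟩
    exact hpa j (by simpa using h2)

/-- Every edge of `d'` missing from `d` completes some `a → w → c`, `w ↔ c` of `(d, b)`. -/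
def Completes {n : ℕ} (d b d' : Dir n) : Prop :=
  ∀ a c, d' a c = true → d a c = true ∨ ∃ w, d a w = true ∧ d w c = true ∧ b w c = true

theorem Completes.reach {n : ℕ} {d b d' : Dir n} (h : Completes d b d') {x y : Fin n}
    (hr : Reach d' x y) : Reach d x y := by
  induction hr with
  | refl => exact .refl
  | tail _ hs ih =>
    rcases h _ _ hs with h | ⟨w, h1, h2, -⟩
    · exact Relation.ReflTransGen.tail ih h
    · exact Relation.ReflTransGen.tail (Relation.ReflTransGen.tail ih h1) h2

theorem Completes.step {n : ℕ} {d b d' : Dir n} (h : Completes d b d')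
    (hb : ∀ v w, b v w = b w v) (Z : Finset (Fin n)) {u v : Fin n} {k : EdgeKind}
    (hs : Step d' b u k v) : Step d b u k v ∨ ∃ x l m, Step d b u l x ∧ Step d b x m v ∧
      Passable d Z x l m ∧ l.intoFst = k.intoFst ∧ m.intoSnd = k.intoSnd := by
  have hself : ∀ x ∈ Z, ∃ y ∈ Z, Reach d x y := fun x hx => ⟨x, hx, .refl⟩
  cases k with
  | fwd =>
    rcases h u v (hs.1 rfl) with h | ⟨w, h1, h2, h3⟩
    · exact .inl (by simpa [Step] using h)
    · by_cases hw : w ∈ Z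
      · exact .inr ⟨w, .fwd, .bidir, by simpa [Step] using h1, by simpa [Step] using h3,
          by simpa [Passable, EdgeKind.intoFst, EdgeKind.intoSnd] using hself w hw, rfl, rfl⟩
      · exact .inr ⟨w, .fwd, .fwd, by simpa [Step] using h1, by simpa [Step] using h2,
          by simpa [Passable, EdgeKind.intoFst, EdgeKind.intoSnd] using hw, rfl, rfl⟩
  | bwd =>
    rcases h v u (hs.2.1 rfl) with h | ⟨w, h1, h2, h3⟩
    · exact .inl (by simpa [Step] using h)
    · by_cases hw : w ∈ Z
      · exact .inr ⟨w, .bidir, .bwd, by simpa [Step, hb u w] using h3, by simpa [Step] using h1,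
          by simpa [Passable, EdgeKind.intoFst, EdgeKind.intoSnd] using hself w hw, rfl, rfl⟩
      · exact .inr ⟨w, .bwd, .bwd, by simpa [Step] using h2, by simpa [Step] using h1,
          by simpa [Passable, EdgeKind.intoFst, EdgeKind.intoSnd] using hw, rfl, rfl⟩
  | bidir => exact .inl (by simpa [Step] using hs)

theorem Completes.activeTo {n : ℕ} {d b d' : Dir n} (h : Completes d b d')
    (hb : ∀ v w, b v w = b w v) {Z : Finset (Fin n)} {u v : Fin n} {k : EdgeKind}
    (ha : ActiveTo d' b Z u v k) : ∃ l, l.intoSnd = k.intoSnd ∧ ActiveTo d b Z u v l := by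
  induction ha with
  | single hs =>
    rcases h.step hb Z hs with hs | ⟨x, l, m, h1, h2, h3, -, h5⟩
    · exact ⟨_, rfl, .single hs⟩
    · exact ⟨m, h5, .snoc (.single h1) h2 h3⟩
  | @snoc v w k k' _ hs hp ih =>
    obtain ⟨j, hj, hja⟩ := ih
    have hp' : ∀ l : EdgeKind, l.intoFst = k'.intoFst → Passable d Z v j l := by
      intro l hl
      unfold Passable at hp ⊢
      rw [hj, hl]
      exact ⟨fun hc => (hp.1 hc).imp fun x hx => ⟨hx.1, h.reach hx.2⟩, hp.2⟩
    rcases h.step hb Z hs with hs | ⟨x, l, m, h1, h2, h3, h4, h5⟩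
    · exact ⟨_, rfl, .snoc hja hs (hp' _ rfl)⟩
    · exact ⟨m, h5, .snoc (.snoc hja h1 (hp' _ h4)) h2 h3⟩

theorem ActiveTo.mono {n : ℕ} {d b d' : Dir n} (h : ∀ a c, d a c = true → d' a c = true)
    {Z : Finset (Fin n)} {u v : Fin n} {k : EdgeKind} (ha : ActiveTo d b Z u v k) :
    ActiveTo d' b Z u v k := by
  have hst : ∀ {x y k}, Step d b x k y → Step d' b x k y := fun hs =>
    ⟨fun e => h _ _ (hs.1 e), fun e => h _ _ (hs.2.1 e), hs.2.2⟩
  induction ha with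
  | single hs => exact .single (hst hs)
  | snoc _ hs hp ih =>
    exact .snoc ih (hst hs) ⟨fun hc => (hp.1 hc).imp fun x hx =>
      ⟨hx.1, Relation.ReflTransGen.mono h _ _ hx.2⟩, hp.2⟩

/-- Adding directed edges that complete copies of `S` to copies of `S̄` preserves Markov
equivalence. -/
theorem Completes.markovEquiv {n : ℕ} {d b d' : Dir n} (h : Completes d b d')
    (hb : ∀ v w, b v w = b w v) (hle : ∀ a c, d a c = true → d' a c = true) :
    MarkovEquiv d b d' b := by
  intro u v Z huv _ _
  rw [dConn_iff_activeTo huv, dConn_iff_activeTo huv]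
  exact ⟨fun ⟨k, hk⟩ => ⟨k, hk.mono hle⟩,
    fun ⟨k, hk⟩ => (h.activeTo hb hk).imp fun _ => And.right⟩

theorem MarkovEquiv.trans_symm {n : ℕ} {d b d' b' d'' b'' : Dir n}
    (h : MarkovEquiv d b d' b') (h' : MarkovEquiv d'' b'' d' b') :
    MarkovEquiv d b d'' b'' :=
  fun u v Z h1 h2 h3 => (h u v Z h1 h2 h3).trans (h' u v Z h1 h2 h3).symm

theorem Acyclic.exists_rank {n : ℕ} {d : Dir n} (h : Acyclic d) :
    ∃ r : Fin n → ℕ, ∀ a c, d a c = true → r a < r c := by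
  classical
  refine ⟨fun v => (Finset.univ.filter fun u =>
    Relation.TransGen (fun a b => d a b = true) u v).card, fun a c hac => ?_⟩
  apply Finset.card_lt_card
  rw [Finset.ssubset_iff_of_subset]
  · exact ⟨a, Finset.mem_filter.2 ⟨Finset.mem_univ _, .single hac⟩,
      fun ha => h a (Finset.mem_filter.1 ha).2⟩
  · intro u hu
    simp only [Finset.mem_filter, Finset.mem_univ, true_and] at hu ⊢
    exact hu.tail hac

theorem isDAG_of_rank {n : ℕ} {d : Dir n} {r : Fin n → ℕ}
    (h : ∀ a c, d a c = true → r a < r c) : IsDAG d := by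
  refine ⟨fun v => ?_, fun v hv => ?_⟩
  · by_contra hc
    exact lt_irrefl _ (h v v (by simpa using hc))
  · have key : ∀ x y, Relation.TransGen (fun a b => d a b = true) x y → r x < r y := by
      intro x y hxy
      induction hxy with
      | single hs => exact h _ _ hs
      | tail _ hs ih => exact ih.trans (h _ _ hs)
    exact lt_irrefl _ (key v v hv)

/-- A finite graph in which every vertex points to at most two vertices, both of smaller
rank, has a proper `3`-colouring. -/
theorem exists_three_coloring {α : Type*} [DecidableEq α] (f g : α → α) (rk : α → ℕ)
    (P : Finset α) (hf : ∀ p ∈ P, rk (f p) < rk p) (hg : ∀ p ∈ P, rk (g p) < rk p) :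
    ∃ c : α → Fin 3, ∀ p ∈ P, (f p ∈ P → c (f p) ≠ c p) ∧ (g p ∈ P → c (g p) ≠ c p) := by
  induction P using Finset.induction_on_max_value rk with
  | empty => exact ⟨fun _ => 0, by simp⟩
  | insert a s ha hmax ih =>
    obtain ⟨c, hc⟩ := ih (fun p hp => hf p (Finset.mem_insert_of_mem hp))
      (fun p hp => hg p (Finset.mem_insert_of_mem hp))
    obtain ⟨i, hi, hi'⟩ : ∃ i : Fin 3, c (f a) ≠ i ∧ c (g a) ≠ i := by
      generalize c (f a) = x
      generalize c (g a) = y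
      revert x y
      decide
    have hfa : ∀ p ∈ insert a s, f p ≠ a := by
      rintro p hp rfl
      have h1 := hf p hp
      rcases Finset.mem_insert.1 hp with h | h
      · rw [← h] at h1
        exact lt_irrefl _ h1
      · exact absurd (hmax p h) (not_le.2 h1)
    have hga : ∀ p ∈ insert a s, g p ≠ a := by
      rintro p hp rfl
      have h1 := hg p hp
      rcases Finset.mem_insert.1 hp with h | h
      · rw [← h] at h1
        exact lt_irrefl _ h1
      · exact absurd (hmax p h) (not_le.2 h1)
    refine ⟨Function.update c a i, fun p hp => ?_⟩
    rw [Function.update_of_ne (hfa p hp), Function.update_of_ne (hga p hp)]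
    rcases eq_or_ne p a with rfl | hpa
    · rw [Function.update_self]
      exact ⟨fun _ => hi, fun _ => hi'⟩
    · rw [Function.update_of_ne hpa]
      have := hc p (Finset.mem_of_mem_insert_of_ne hp hpa)
      exact ⟨fun h => this.1 (Finset.mem_of_mem_insert_of_ne h (hfa p hp)),
        fun h => this.2 (Finset.mem_of_mem_insert_of_ne h (hga p hp))⟩

theorem exists_large_independent {α : Type*} [DecidableEq α] (f g : α → α) (rk : α → ℕ)
    (P : Finset α) (hf : ∀ p ∈ P, rk (f p) < rk p) (hg : ∀ p ∈ P, rk (g p) < rk p) :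
    ∃ I ⊆ P, P.card ≤ 3 * I.card ∧ ∀ p ∈ I, f p ∉ I ∧ g p ∉ I := by
  obtain ⟨c, hc⟩ := exists_three_coloring f g rk P hf hg
  obtain ⟨i, hi⟩ : ∃ i : Fin 3, P.card ≤ 3 * (P.filter fun p => c p = i).card := by
    by_contra! hlt
    have hsum := Finset.card_eq_sum_card_fiberwise (f := c) (s := P) (t := Finset.univ)
      (by simp)
    rw [Fin.sum_univ_three] at hsum
    have h0 := hlt 0
    have h1 := hlt 1
    have h2 := hlt 2
    omega
  refine ⟨_, Finset.filter_subset _ _, hi, fun p hp => ?_⟩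
  simp only [Finset.mem_filter] at hp ⊢
  exact ⟨fun h => (hc p hp.1).1 h.1 (h.2.trans hp.2.symm),
    fun h => (hc p hp.1).2 h.1 (h.2.trans hp.2.symm)⟩

/-- Add every edge `a → c` with `a → w → c`, `w ↔ c` for some `w`. -/
def complete {n : ℕ} (d b : Dir n) : Dir n :=
  fun a c => decide (d a c = true ∨ ∃ w, d a w = true ∧ d w c = true ∧ b w c = true)

/-- Delete the edges in `F`. -/
def deleteEdges {n : ℕ} (d : Dir n) (F : Finset (Fin n × Fin n)) : Dir n :=
  fun a c => d a c && decide ((a, c) ∉ F)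

theorem deleteEdges_eq_true {n : ℕ} {d : Dir n} {F : Finset (Fin n × Fin n)} {a c : Fin n} :
    deleteEdges d F a c = true ↔ d a c = true ∧ (a, c) ∉ F := by
  simp [deleteEdges]

theorem complete_eq_true {n : ℕ} {d b : Dir n} {a c : Fin n} :
    complete d b a c = true ↔
      (d a c = true ∨ ∃ w, d a w = true ∧ d w c = true ∧ b w c = true) := by
  simp [complete]

/-- If every pair `(a, c)` in `I` is completed by some `a → w → c`, `w ↔ c` with
`(a, w), (w, c) ∉ I`, then the Markov equivalence class has at least `2 ^ #I` elements. -/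
theorem two_pow_card_le_ncard_MECadmg {n : ℕ} {d b : Dir n} (hG : IsADMG d b)
    (mid : Fin n × Fin n → Fin n) (I : Finset (Fin n × Fin n))
    (hI : ∀ p ∈ I, d p.1 (mid p) = true ∧ d (mid p) p.2 = true ∧ b (mid p) p.2 = true)
    (hind : ∀ p ∈ I, (p.1, mid p) ∉ I ∧ (mid p, p.2) ∉ I) :
    2 ^ I.card ≤ (MECadmg d b).ncard := by
  obtain ⟨r, hr⟩ := hG.1.2.exists_rank
  have hrc : ∀ a c, complete d b a c = true → r a < r c := by
    intro a c h
    rcases complete_eq_true.1 h with h | ⟨w, h1, h2, -⟩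
    · exact hr _ _ h
    · exact (hr _ _ h1).trans (hr _ _ h2)
  have hcomp : MarkovEquiv d b (complete d b) b :=
    Completes.markovEquiv (fun _ _ h => complete_eq_true.1 h) hG.2.1
      fun _ _ h => complete_eq_true.2 (.inl h)
  rw [← Finset.card_powerset, ← Set.ncard_coe_finset]
  refine Set.ncard_le_ncard_of_injOn (fun F => (deleteEdges (complete d b) F, b)) ?_ ?_
    (Set.toFinite _)
  · intro F hF
    have hF : F ⊆ I := by simpa using hF
    refine ⟨⟨isDAG_of_rank fun a c h => hrc a c (deleteEdges_eq_true.1 h).1, hG.2⟩,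
      hcomp.trans_symm (Completes.markovEquiv ?_ hG.2.1
        fun _ _ h => (deleteEdges_eq_true.1 h).1)⟩
    intro a c h
    by_cases hac : (a, c) ∈ F
    · have h1 := hI _ (hF hac)
      have h2 := hind _ (hF hac)
      exact .inr ⟨mid (a, c),
        deleteEdges_eq_true.2 ⟨complete_eq_true.2 (.inl h1.1), fun h => h2.1 (hF h)⟩,
        deleteEdges_eq_true.2 ⟨complete_eq_true.2 (.inl h1.2.1), fun h => h2.2 (hF h)⟩,
        h1.2.2⟩
    · exact .inl (deleteEdges_eq_true.2 ⟨h, hac⟩)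
  · have key : ∀ F F' : Finset (Fin n × Fin n), F ⊆ I →
        deleteEdges (complete d b) F = deleteEdges (complete d b) F' → F ⊆ F' := by
      intro F F' hF heq p hp
      by_contra hp'
      have h1 : deleteEdges (complete d b) F' p.1 p.2 = true :=
        deleteEdges_eq_true.2 ⟨complete_eq_true.2 (.inr ⟨mid p, hI p (hF hp)⟩), hp'⟩
      rw [← heq] at h1
      exact (deleteEdges_eq_true.1 h1).2 hp
    intro F hF F' hF' heq
    have heq := congrArg Prod.fst heq
    exact (key F F' (by simpa using hF) heq).antisymm (key F' F (by simpa using hF') heq.symm)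

/-- Corollary 4.3: if an ADMG on `n` vertices has `m` distinct
`3`-element vertex subsets each inducing a copy of `S` or of `S̄`, then
`|MEC(G)| ≥ 2 ^ (m / (3n))`. -/
theorem admg_many_copies_mec_lower_bound (n m : ℕ) (d b : Dir n) (hG : IsADMG d b)
    (𝒱 : Finset (Finset (Fin n))) (hm : 𝒱.card = m)
    (h3 : ∀ W ∈ 𝒱, W.card = 3)
    (hS : ∀ W ∈ 𝒱, ∃ v₁ v₂ v₃ : Fin n, W = {v₁, v₂, v₃} ∧
      ((d v₁ v₂ = true ∧ d v₂ v₃ = true ∧ b v₂ v₃ = true) ∨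
        (d v₁ v₂ = true ∧ d v₂ v₃ = true ∧ b v₂ v₃ = true ∧ d v₁ v₃ = true))) :
    (2 : ℝ) ^ ((m : ℝ) / (3 * (n : ℝ))) ≤ ((MECadmg d b).ncard : ℝ) := by
  classical
  rcases n.eq_zero_or_pos with rfl | hn
  · simpa using two_pow_card_le_ncard_MECadmg hG Prod.fst ∅ (by simp) (by simp)
  have : Nonempty (Fin n) := ⟨⟨0, hn⟩⟩
  choose! x y z hW hxyz using hS
  have hedge : ∀ W ∈ 𝒱, d (x W) (y W) = true ∧ d (y W) (z W) = true ∧ b (y W) (z W) = true :=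
    fun W hWm => (hxyz W hWm).elim id fun h => ⟨h.1, h.2.1, h.2.2.1⟩
  set P := 𝒱.image fun W => (x W, z W)
  have hPcard : 𝒱.card ≤ n * P.card := by
    refine Finset.card_le_mul_card_image 𝒱 n fun p hp => ?_
    refine (Finset.card_le_card_of_injOn (t := Finset.univ) y (by simp) ?_).trans_eq
      (Finset.card_fin n)
    intro W hWm W' hWm' hy
    simp only [Finset.coe_filter, Set.mem_ofPred_eq] at hWm hWm'
    have hp := hWm.2.trans hWm'.2.symm
    rw [Prod.mk.injEq] at hp
    rw [hW W hWm.1, hW W' hWm'.1, hp.1, hp.2, hy]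
  have hmid : ∀ p ∈ P, ∃ w, d p.1 w = true ∧ d w p.2 = true ∧ b w p.2 = true := by
    intro p hp
    obtain ⟨W, hWm, rfl⟩ := Finset.mem_image.1 hp
    exact ⟨y W, hedge W hWm⟩
  choose! mid hmid using hmid
  obtain ⟨r, hr⟩ := hG.1.2.exists_rank
  obtain ⟨I, hIP, hIcard, hind⟩ := exists_large_independent
    (fun p : Fin n × Fin n => (p.1, mid p)) (fun p => (mid p, p.2)) (fun p => r p.2 - r p.1) P
    (fun p hp => by
      have h1 := hr _ _ (hmid p hp).1
      have h2 := hr _ _ (hmid p hp).2.1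
      dsimp only
      omega)
    (fun p hp => by
      have h1 := hr _ _ (hmid p hp).1
      have h2 := hr _ _ (hmid p hp).2.1
      dsimp only
      omega)
  have hmain := two_pow_card_le_ncard_MECadmg hG mid I (fun p hp => hmid p (hIP hp)) hind
  have hle : (m : ℝ) / (3 * n) ≤ I.card := by
    refine div_le_of_le_mul₀ (by positivity) (by positivity) ?_
    have : m ≤ I.card * (3 * n) := by
      calc m ≤ n * P.card := hm ▸ hPcard
        _ ≤ n * (3 * I.card) := Nat.mul_le_mul_left _ hIcard
        _ = _ := by ring
    exact_mod_cast this
  calc (2 : ℝ) ^ ((m : ℝ) / (3 * n)) ≤ 2 ^ (I.card : ℝ) :=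
        Real.rpow_le_rpow_of_exponent_le (by norm_num) hle
    _ = ((2 ^ I.card : ℕ) : ℝ) := by rw [Real.rpow_natCast]; push_cast; rfl
    _ ≤ _ := by exact_mod_cast hmain

end CausalMEC
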